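/- arXiv:2602.23116 — 4 statements merged into one kernel-verified Lean document; each statement's English description precedes it below -/
import Mathlib

section
/- (Coverage Lemma) Let I be a finite nonempty set, w a probability mass function on I, and ũ : I → ℝ^d vectors such that Σ_{i ∈ I} w(i) ũ(i) ũ(i)ᵀ ⪰ C_min · I_d for some C_min > 0 (Loewner order). Then for every positive semidefinite matrix M ∈ ℝ^{d²×d²} and every vector φ ∈ ℝ^d: Σ_{j=1}^d (φ ⊗ e_j)ᵀ M (φ ⊗ e_j) ≤ C_min⁻¹ · Σ_{i ∈ I} w(i) (φ ⊗ ũ(i))ᵀ M (φ ⊗ ũ(i)), where ⊗ denotes the Kronecker product of vectors and e_1, …, e_d is the standard basis of ℝ^d. -/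
open scoped BigOperators
open Matrix

noncomputable section

/-- Kronecker product of two vectors in `ℝ^d`, viewed as a vector in `ℝ^{d²}`. -/
def kron {d : ℕ} (u v : Fin d → ℝ) : Fin d × Fin d → ℝ := fun p => u p.1 * v p.2

/-- A lower Loewner bound on a weighted second-moment matrix, evaluated at a vector. -/
lemma mul_dotProduct_self_le_of_posSemidef {I ι : Type*} [Fintype I] [Fintype ι] [DecidableEq ι]
    {w : I → ℝ} {u : I → ι → ℝ} {c : ℝ}
    (h : ((∑ i, w i • Matrix.vecMulVec (u i) (u i)) - c • (1 : Matrix ι ι ℝ)).PosSemidef)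
    (x : ι → ℝ) :
    c * (x ⬝ᵥ x) ≤ ∑ i, w i * (x ⬝ᵥ u i) ^ 2 := by
  have hx := h.dotProduct_mulVec_nonneg x
  simp only [star_trivial, sub_mulVec, sum_mulVec, smul_mulVec, one_mulVec, dotProduct_sub,
    dotProduct_sum, dotProduct_smul, vecMulVec_mulVec, smul_eq_mul] at hx
  refine (sub_nonneg.mp hx).trans_eq (Finset.sum_congr rfl fun i _ => ?_)
  simp [dotProduct_comm (u i) x, sq]

/-- A quadratic form with a Gram matrix, restricted to the vectors `kron φ v`, is a sum of squares
of linear forms in `v`. -/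
lemma kron_dotProduct_gram_mulVec {d : ℕ} {κ : Type*} [Fintype κ]
    (A : Matrix κ (Fin d × Fin d) ℝ) (φ v : Fin d → ℝ) :
    kron φ v ⬝ᵥ (Aᵀ * A).mulVec (kron φ v) =
      ∑ p, ((fun k => ∑ a, A p (a, k) * φ a) ⬝ᵥ v) ^ 2 := by
  rw [← mulVec_mulVec, dotProduct_mulVec, vecMul_transpose]
  refine Finset.sum_congr rfl fun p _ => ?_
  rw [← sq]
  congr 1
  simp only [mulVec, dotProduct, kron, Fintype.sum_prod_type_right, Finset.sum_mul, mul_assoc]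

open scoped MatrixOrder in
/-- A real positive semidefinite matrix is a Gram matrix. -/
lemma exists_eq_transpose_mul_self_of_posSemidef {n : Type*} [Fintype n] [DecidableEq n]
    {M : Matrix n n ℝ} (hM : M.PosSemidef) : ∃ A : Matrix n n ℝ, M = Aᵀ * A := by
  obtain ⟨A, rfl⟩ := CStarAlgebra.nonneg_iff_eq_star_mul_self.mp hM.nonneg
  exact ⟨A, by rw [star_eq_conjTranspose, conjTranspose_eq_transpose_of_trivial]⟩

/-- Coverage Lemma, Lemma B.2. -/
theorem stmt7 {I : Type} [Fintype I] [Nonempty I] {d : ℕ}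
    (w : I → ℝ) (hw : ∀ i, 0 ≤ w i) (hwsum : ∑ i, w i = 1)
    (u : I → Fin d → ℝ) (Cmin : ℝ) (hC : 0 < Cmin)
    (hcov : ((∑ i, w i • Matrix.vecMulVec (u i) (u i)) -
      Cmin • (1 : Matrix (Fin d) (Fin d) ℝ)).PosSemidef)
    (M : Matrix (Fin d × Fin d) (Fin d × Fin d) ℝ) (hM : M.PosSemidef)
    (φ : Fin d → ℝ) :
    ∑ j, kron φ (Pi.single j 1) ⬝ᵥ M.mulVec (kron φ (Pi.single j 1)) ≤
      Cmin⁻¹ * ∑ i, w i * (kron φ (u i) ⬝ᵥ M.mulVec (kron φ (u i))) := by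
  obtain ⟨A, rfl⟩ := exists_eq_transpose_mul_self_of_posSemidef hM
  rw [le_inv_mul_iff₀ hC]
  simp only [kron_dotProduct_gram_mulVec, Finset.mul_sum]
  rw [Finset.sum_comm, Finset.sum_comm (s := (Finset.univ : Finset I))]
  refine Finset.sum_le_sum fun p _ => ?_
  have h := mul_dotProduct_self_le_of_posSemidef hcov (fun k => ∑ a, A p (a, k) * φ a)
  simp only [dotProduct_single_one, ← Finset.mul_sum]
  simpa only [dotProduct, ← sq] using h
end
end

section
/- Let I be a finite nonempty set, w a probability mass function on I, and u : I → ℝ^d vectors such that Σ_{i ∈ I} w(i) u(i) u(i)ᵀ ⪰ C · I_d for some C > 0 (Loewner order). Then Σ_{i ∈ I} Σ_{j ∈ I} w(i) w(j) (u(j) ⊗ u(i)) (u(j) ⊗ u(i))ᵀ ⪰ C² · I_{d²}, where ⊗ denotes the Kronecker product of vectors. Equivalently, the minimum eigenvalue of the d²×d² second-moment matrix of the product features is at least the square of the minimum eigenvalue of the d×d second-moment matrix. -/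
open scoped BigOperators
open Matrix

noncomputable section

open scoped Kronecker in
/-- If `A ⪰ C • 1` with `0 ≤ C`, then `A ⊗ A ⪰ C ^ 2 • 1`. -/
theorem Matrix.PosSemidef.kronecker_self_sub_sq_smul_one {n : Type*} [Fintype n] [DecidableEq n]
    {A : Matrix n n ℝ} {C : ℝ} (hC : 0 ≤ C) (h : (A - C • (1 : Matrix n n ℝ)).PosSemidef) :
    (A ⊗ₖ A - C ^ 2 • (1 : Matrix (n × n) (n × n) ℝ)).PosSemidef := by
  set P := A - C • (1 : Matrix n n ℝ) with hP
  have hA : A = P + C • (1 : Matrix n n ℝ) := by simp [hP]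
  have key : A ⊗ₖ A - C ^ 2 • (1 : Matrix (n × n) (n × n) ℝ) =
      P ⊗ₖ P + C • (P ⊗ₖ (1 : Matrix n n ℝ) + (1 : Matrix n n ℝ) ⊗ₖ P) := by
    rw [hA, Matrix.add_kronecker, Matrix.kronecker_add, Matrix.kronecker_add]
    simp only [Matrix.smul_kronecker, Matrix.kronecker_smul, Matrix.one_kronecker_one]
    module
  rw [key]
  exact (h.kronecker h).add
    (((h.kronecker Matrix.PosSemidef.one).add (Matrix.PosSemidef.one.kronecker h)).smul hC)

open scoped Kronecker in
/-- The second-moment matrix of the product features is the Kronecker square of the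
second-moment matrix of the features. -/
theorem sum_sum_smul_vecMulVec_kron {I : Type*} [Fintype I] {d : ℕ}
    (w : I → ℝ) (u : I → Fin d → ℝ) :
    ∑ i, ∑ j, (w i * w j) • Matrix.vecMulVec (kron (u j) (u i)) (kron (u j) (u i)) =
      (∑ i, w i • Matrix.vecMulVec (u i) (u i)) ⊗ₖ
        (∑ i, w i • Matrix.vecMulVec (u i) (u i)) := by
  ext p q
  simp only [Matrix.sum_apply, Matrix.smul_apply, Matrix.vecMulVec_apply, kron,
    Matrix.kroneckerMap_apply, smul_eq_mul]
  rw [Finset.sum_mul_sum, Finset.sum_comm]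
  refine Finset.sum_congr rfl fun i _ => Finset.sum_congr rfl fun j _ => ?_
  ring

/-- if the second-moment matrix of the features is at least `C·I_d` in the
Loewner order, then the second-moment matrix of the Kronecker-product features is at least
`C²·I_{d²}`. -/
theorem stmt9 {I : Type} [Fintype I] [Nonempty I] {d : ℕ}
    (w : I → ℝ) (hw : ∀ i, 0 ≤ w i) (hwsum : ∑ i, w i = 1)
    (u : I → Fin d → ℝ) (C : ℝ) (hC : 0 < C)
    (hcov : ((∑ i, w i • Matrix.vecMulVec (u i) (u i)) -
      C • (1 : Matrix (Fin d) (Fin d) ℝ)).PosSemidef) :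
    ((∑ i, ∑ j, (w i * w j) • Matrix.vecMulVec (kron (u j) (u i)) (kron (u j) (u i))) -
      C ^ 2 • (1 : Matrix (Fin d × Fin d) (Fin d × Fin d) ℝ)).PosSemidef := by
  rw [sum_sum_smul_vecMulVec_kron]
  exact hcov.kronecker_self_sub_sq_smul_one hC.le
end
end

section
/- (No regularization strength yields polynomially sublinear unregularized regret from the exponential-in-η bound) For all real constants A > 0, D > 0, C > 0 and every γ ∈ (0,1], and for every function η : ℕ → (0,∞), there exists an integer T ≥ 2 such that A · e^{η(T)} · log T + D · T / η(T) > C · T^{1−γ}. In other words, no choice of the regularization strength η (even as a function of the horizon T) can make the quantity A e^{η} log T + η⁻¹ D T be bounded by C T^{1−γ} for all T ≥ 2. -/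
/-- Stretched exponentials along the naturals eventually dominate any linear function. -/
theorem tendsto_exp_mul_rpow_div_natCast_atTop {b γ : ℝ} (hb : 0 < b) (hγ : 0 < γ) :
    Filter.Tendsto (fun T : ℕ => Real.exp (b * (T : ℝ) ^ γ) / T) Filter.atTop Filter.atTop := by
  have h := (tendsto_exp_mul_div_rpow_atTop (1 / γ) b hb).comp
    ((tendsto_rpow_atTop hγ).comp (tendsto_natCast_atTop_atTop (R := ℝ)))
  refine h.congr fun T => ?_
  simp only [Function.comp_apply]
  rw [← Real.rpow_mul (Nat.cast_nonneg T), mul_one_div_cancel hγ.ne', Real.rpow_one]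

/-- no choice of regularization strength `η` (even as a function of the
horizon `T`) can make `A e^{η(T)} log T + η(T)⁻¹ D T` bounded by `C T^{1−γ}` for all
`T ≥ 2`. -/
theorem stmt15 (A D C : ℝ) (hA : 0 < A) (hD : 0 < D) (hC : 0 < C)
    (γ : ℝ) (hγ0 : 0 < γ) (hγ1 : γ ≤ 1)
    (η : ℕ → ℝ) (hη : ∀ T, 0 < η T) :
    ∃ T : ℕ, 2 ≤ T ∧
      C * (T : ℝ) ^ (1 - γ) < A * Real.exp (η T) * Real.log T + D * T / η T := by
  have hlog2 : 0 < Real.log 2 := Real.log_pos one_lt_two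
  obtain ⟨T, hT, hT2⟩ :=
    (((tendsto_exp_mul_rpow_div_natCast_atTop (div_pos hD hC) hγ0).eventually_gt_atTop
      (C / (A * Real.log 2))).and (Filter.eventually_ge_atTop 2)).exists
  refine ⟨T, hT2, ?_⟩
  have hT2' : (2 : ℝ) ≤ T := by exact_mod_cast hT2
  have hTpos : (0 : ℝ) < T := by linarith
  have hη' := hη T
  have hlog : Real.log 2 ≤ Real.log T := Real.log_le_log two_pos hT2'
  have hpow : 0 < (T : ℝ) ^ γ := Real.rpow_pos_of_pos hTpos γ
  have hfirst : 0 < A * Real.exp (η T) * Real.log T :=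
    mul_pos (mul_pos hA (Real.exp_pos _)) (hlog2.trans_le hlog)
  have hsecond : 0 < D * T / η T := by positivity
  rcases le_total (η T) (D / C * (T : ℝ) ^ γ) with h | h
  · have : C * (T : ℝ) ^ (1 - γ) ≤ D * T / η T := by
      rw [Real.rpow_sub hTpos, Real.rpow_one]
      calc C * (T / (T : ℝ) ^ γ) = D * T / (D / C * (T : ℝ) ^ γ) := by field_simp
        _ ≤ D * T / η T := by gcongr
    linarith
  · rw [div_lt_div_iff₀ (by positivity) hTpos] at hT
    have hle : (T : ℝ) ^ (1 - γ) ≤ T :=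
      (Real.rpow_le_rpow_of_exponent_le (by linarith) (by linarith)).trans_eq (Real.rpow_one _)
    calc C * (T : ℝ) ^ (1 - γ) ≤ C * T := by gcongr
      _ < Real.exp (D / C * (T : ℝ) ^ γ) * (A * Real.log 2) := hT
      _ = A * Real.exp (D / C * (T : ℝ) ^ γ) * Real.log 2 := by ring
      _ ≤ A * Real.exp (η T) * Real.log T := by gcongr
      _ < _ := lt_add_of_pos_right _ hsecond
end

section
/- (The Wu-style eluder dimension is bounded by the Dirac sequential extrapolation coefficient) Let Z be a nonempty set, P a nonempty collection of functions Z → [0,1], λ > 0, and T ∈ ℕ. Define d(P, λ, T) := sup over all sequences z_1, …, z_T ∈ Z of Σ_{t=1}^T min{ 1, sup_{P₁, P₂ ∈ P} (P₁(z_t) − P₂(z_t))² / ( λ + Σ_{s=1}^{t−1} (P₁(z_s) − P₂(z_s))² ) }, and define the Dirac sequential extrapolation coefficient SEC_λ(P, T) := sup over all sequences P_1¹, …, P_T¹ ∈ P, P_1², …, P_T² ∈ P and z_1, …, z_T ∈ Z of Σ_{t=1}^T (P_t¹(z_t) − P_t²(z_t))² / ( λ + Σ_{s=1}^{t−1} (P_t¹(z_s)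 − P_t²(z_s))² ). Then d(P, λ, T) ≤ SEC_λ(P, T). (Both suprema are finite: each summand of d(P,λ,T) is at most 1 and each summand of SEC_λ(P,T) is at most 1/λ.) -/
open scoped BigOperators

noncomputable section

/-- The Wu-style eluder dimension `d(𝒫, λ, T)`: supremum over sequences of the sum of
clipped squared uncertainties. -/
def dWu {Z : Type} (P : Set (Z → ℝ)) (lam : ℝ) (T : ℕ) : ℝ :=
  ⨆ z : ℕ → Z, ∑ t ∈ Finset.range T,
    min 1 (⨆ P₁ : P, ⨆ P₂ : P,
      (P₁.1 (z t) - P₂.1 (z t)) ^ 2 /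
        (lam + ∑ s ∈ Finset.range t, (P₁.1 (z s) - P₂.1 (z s)) ^ 2))

/-- The Dirac sequential extrapolation coefficient `SEC_λ(𝒫, T)`. -/
def SEC {Z : Type} (P : Set (Z → ℝ)) (lam : ℝ) (T : ℕ) : ℝ :=
  ⨆ P1 : ℕ → P, ⨆ P2 : ℕ → P, ⨆ z : ℕ → Z, ∑ t ∈ Finset.range T,
    ((P1 t).1 (z t) - (P2 t).1 (z t)) ^ 2 /
      (lam + ∑ s ∈ Finset.range t, ((P1 t).1 (z s) - (P2 t).1 (z s)) ^ 2)

theorem exists_ciSup_ciSup_lt_add {ι κ : Type*} [Nonempty ι] [Nonempty κ] (f : ι → κ → ℝ)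
    {ε : ℝ} (hε : 0 < ε) : ∃ i j, (⨆ i, ⨆ j, f i j) < f i j + ε := by
  obtain ⟨i, hi⟩ := exists_lt_of_lt_ciSup
    (show (⨆ i, ⨆ j, f i j) - ε / 2 < ⨆ i, ⨆ j, f i j by linarith)
  obtain ⟨j, hj⟩ := exists_lt_of_lt_ciSup (show (⨆ j, f i j) - ε / 2 < ⨆ j, f i j by linarith)
  exact ⟨i, j, by linarith⟩

theorem le_ciSup_ciSup_ciSup {ι κ μ : Type*} [Nonempty κ] [Nonempty μ] {f : ι → κ → μ → ℝ} {B : ℝ}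
    (hB : ∀ i j k, f i j k ≤ B) (i : ι) (j : κ) (k : μ) :
    f i j k ≤ ⨆ i, ⨆ j, ⨆ k, f i j k := by
  refine le_ciSup_of_le ⟨B, ?_⟩ i (le_ciSup_of_le ⟨B, ?_⟩ j (le_ciSup ⟨B, ?_⟩ k))
  · rintro _ ⟨i, rfl⟩
    exact ciSup_le fun j => ciSup_le fun k => hB i j k
  · rintro _ ⟨j, rfl⟩
    exact ciSup_le fun k => hB i j k
  · rintro _ ⟨k, rfl⟩
    exact hB i j k

theorem sq_sub_div_le_inv {a b lam S : ℝ} (ha : a ∈ Set.Icc (0 : ℝ) 1)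
    (hb : b ∈ Set.Icc (0 : ℝ) 1) (hlam : 0 < lam) (hS : 0 ≤ S) :
    (a - b) ^ 2 / (lam + S) ≤ 1 / lam := by
  have h : (a - b) ^ 2 ≤ 1 := by
    rw [sq_le_one_iff_abs_le_one, abs_le]
    constructor <;> linarith [ha.1, ha.2, hb.1, hb.2]
  exact div_le_div₀ zero_le_one h hlam (by linarith)

theorem sum_le_SEC {Z : Type} [Nonempty Z] {P : Set (Z → ℝ)} [Nonempty P]
    (hP : ∀ f ∈ P, ∀ z, f z ∈ Set.Icc (0 : ℝ) 1) {lam : ℝ} (hlam : 0 < lam) (T : ℕ)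
    (P1 P2 : ℕ → P) (z : ℕ → Z) :
    ∑ t ∈ Finset.range T, ((P1 t).1 (z t) - (P2 t).1 (z t)) ^ 2 /
      (lam + ∑ s ∈ Finset.range t, ((P1 t).1 (z s) - (P2 t).1 (z s)) ^ 2) ≤ SEC P lam T :=
  le_ciSup_ciSup_ciSup (B := ∑ _t ∈ Finset.range T, 1 / lam)
    (f := fun (P1 P2 : ℕ → P) (z : ℕ → Z) => ∑ t ∈ Finset.range T,
      ((P1 t).1 (z t) - (P2 t).1 (z t)) ^ 2 /
        (lam + ∑ s ∈ Finset.range t, ((P1 t).1 (z s) - (P2 t).1 (z s)) ^ 2))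
    (fun P1 P2 _ => Finset.sum_le_sum fun t _ =>
      sq_sub_div_le_inv (hP _ (P1 t).2 _) (hP _ (P2 t).2 _) hlam
        (Finset.sum_nonneg fun _ _ => sq_nonneg _)) P1 P2 z

/-- Proposition E.2, upper-bound half: the Wu-style eluder dimension is
bounded by the Dirac sequential extrapolation coefficient. -/
theorem stmt19 {Z : Type} [Nonempty Z] (P : Set (Z → ℝ)) (hne : P.Nonempty)
    (hP : ∀ f ∈ P, ∀ z, f z ∈ Set.Icc (0 : ℝ) 1)
    (lam : ℝ) (hlam : 0 < lam) (T : ℕ) :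
    dWu P lam T ≤ SEC P lam T := by
  have : Nonempty P := hne.to_subtype
  refine ciSup_le fun z => le_of_forall_pos_le_add fun ε hε => ?_
  have hδ : 0 < ε / (T + 1) := by positivity
  choose P1 P2 h using fun t : ℕ => exists_ciSup_ciSup_lt_add (fun P₁ P₂ : P =>
    (P₁.1 (z t) - P₂.1 (z t)) ^ 2 /
      (lam + ∑ s ∈ Finset.range t, (P₁.1 (z s) - P₂.1 (z s)) ^ 2)) hδ
  have hT : T * (ε / (T + 1)) ≤ ε := by
    rw [mul_div_assoc', div_le_iff₀ (by positivity)]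
    nlinarith
  refine (Finset.sum_le_sum fun t _ => (min_le_right _ _).trans (h t).le).trans ?_
  rw [Finset.sum_add_distrib, Finset.sum_const, Finset.card_range, nsmul_eq_mul]
  exact add_le_add (sum_le_SEC hP hlam T P1 P2 z) hT
end
end
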